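/- For each integer $k \ge 0$, the function $I_k(\lambda) = \int_0^1 x^k |\sin x|^\lambda\,dx$, defined and holomorphic for $\mathrm{Re}\,\lambda > -(k+1)$, admits a meromorphic extension to $\mathbb{C}$ given by $I_k(\lambda) = \sum_{j=0}^\infty \frac{c_j(\lambda)}{\lambda + k + 2j + 1}$, with simple poles exactly at $\lambda = -(k+2j+1)$ for $j = 0,1,2,\dots$ (whenever $c_j(-(k+2j+1)) \neq 0$), and residue at $\lambda = -(k+2j+1)$ equal to $c_j(-(k+2j+1))$. -/

import Mathlib

open scoped Real Topology
open Filter MeasureTheory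

/-- A bound on the cosine that keeps `sin z / z` away from the branch cut near the unit disc. -/
theorem norm_cos_sub_one_lt {z : ℂ} (hz : ‖z‖ < 5 / 4) : ‖Complex.cos z - 1‖ < 1 := by
  have hw : ‖z / 2‖ ≤ 5 / 8 := by rw [norm_div]; norm_num; linarith
  have hs := Complex.sin_bound (x := z / 2) (by linarith)
  set w := z / 2 with hwz
  have h1 : ‖Complex.sin w‖ ≤ ‖w‖ + ‖w‖ ^ 3 / 6 + ‖w‖ ^ 5 / 100 := by
    calc ‖Complex.sin w‖ = ‖w - w ^ 3 / 6 + (Complex.sin w - (w - w ^ 3 / 6))‖ := by ring_nf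
      _ ≤ ‖w - w ^ 3 / 6‖ + ‖Complex.sin w - (w - w ^ 3 / 6)‖ := norm_add_le _ _
      _ ≤ (‖w‖ + ‖w ^ 3 / 6‖) + _ := add_le_add (norm_sub_le _ _) hs
      _ = _ := by simp [norm_pow]
  have h2 : ‖Complex.sin w‖ ≤ 0.7 := by
    calc _ ≤ _ := h1
      _ ≤ 5 / 8 + (5 / 8) ^ 3 / 6 + (5 / 8) ^ 5 / 100 := by gcongr
      _ ≤ _ := by norm_num
  have h3 : Complex.cos z - 1 = -(2 * Complex.sin w ^ 2) := by
    rw [show z = 2 * w by rw [hwz]; ring, Complex.cos_two_mul, Complex.cos_sq']; ring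
  rw [h3, norm_neg, norm_mul, norm_pow]
  have := norm_nonneg (Complex.sin w)
  norm_num
  nlinarith

/-- The entire function `sin z / z` takes values in the slit plane for `‖z‖ < 5 / 4`. -/
theorem dslope_sin_mem_slitPlane {z : ℂ} (hz : ‖z‖ < 5 / 4) :
    dslope Complex.sin 0 z ∈ Complex.slitPlane := by
  rcases eq_or_ne z 0 with rfl | hz0
  · simp [dslope_same]
  · rw [dslope_of_ne _ hz0, slope_def_field, Complex.sin_zero, sub_zero, sub_zero]
    obtain ⟨y, hy, hmax⟩ := (isCompact_closedBall (0 : ℂ) ‖z‖).exists_isMaxOn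
      ⟨0, by simp⟩ (f := fun w => ‖Complex.cos w - 1‖) (by fun_prop)
    have hC : ‖Complex.cos y - 1‖ < 1 :=
      norm_cos_sub_one_lt (lt_of_le_of_lt (by simpa using hy) hz)
    have hd := (convex_closedBall (0 : ℂ) ‖z‖).norm_image_sub_le_of_norm_hasDerivWithin_le
      (f := fun w => Complex.sin w - w) (f' := fun w => Complex.cos w - 1)
      (fun w _ => ((Complex.hasDerivAt_sin w).sub (hasDerivAt_id w)).hasDerivWithinAt)
      (fun w hw => hmax hw) (x := 0) (y := z) (by simp) (by simp)
    simp only [Complex.sin_zero, sub_zero] at hd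
    have hlt : ‖Complex.sin z / z - 1‖ < 1 := by
      rw [div_sub_one hz0, norm_div, div_lt_one (norm_pos_iff.mpr hz0)]
      have := norm_pos_iff.mpr hz0
      nlinarith
    left
    have := (abs_lt.mp ((Complex.abs_re_le_norm _).trans_lt hlt)).1
    simp only [Complex.sub_re, Complex.one_re] at this
    linarith

/-- Cauchy's estimate for a power series known to represent `f` only on a real interval. -/
theorem norm_coeff_le_of_hasSum_real {f : ℂ → ℂ} {a : ℕ → ℂ} {r : NNReal} {M : ℝ} (hr : 0 < r)
    (hf : DifferentiableOn ℂ f (Metric.closedBall 0 r))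
    (hM : ∀ z ∈ Metric.closedBall (0 : ℂ) r, ‖f z‖ ≤ M)
    (ha : Summable fun n => ‖a n‖)
    (hfa : ∀ x : ℝ, 0 < x → x < 1 → HasSum (fun n => a n * (x : ℂ) ^ n) (f x)) (n : ℕ) :
    ‖a n‖ ≤ M * (r : ℝ)⁻¹ ^ n := by
  set p := FormalMultilinearSeries.ofScalars ℂ a
  have hrad : 0 < p.radius :=
    lt_of_lt_of_le (by simp) (p.le_radius_of_summable_norm (r := 1) (by simpa [p] using ha))
  have hp := (p.hasFPowerSeriesOnBall hrad).hasFPowerSeriesAt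
  have hq := (hf.hasFPowerSeriesOnBall hr).hasFPowerSeriesAt
  have hfreq : ∃ᶠ z : ℂ in 𝓝[≠] 0, p.sum z = f z := by
    have hlim : Tendsto (fun x : ℝ => (x : ℂ)) (𝓝[>] 0) (𝓝[≠] 0) := by
      refine tendsto_nhdsWithin_iff.mpr ⟨?_, ?_⟩
      · exact (Complex.continuous_ofReal.tendsto' 0 0 (by simp)).mono_left nhdsWithin_le_nhds
      · filter_upwards [self_mem_nhdsWithin] with x hx
        simpa using (ne_of_gt hx)
    refine hlim.frequently (Eventually.frequently ?_)
    filter_upwards [Ioo_mem_nhdsGT (zero_lt_one (α := ℝ))] with x hx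
    rw [← (hfa x hx.1 hx.2).tsum_eq]
    simp [p, FormalMultilinearSeries.sum, mul_comm]
  have heq := (hp.analyticAt.frequently_eq_iff_eventually_eq hq.analyticAt).mp hfreq
  have hpq := (hp.congr heq).eq_formalMultilinearSeries hq
  rw [← FormalMultilinearSeries.ofScalars_norm (𝕜 := ℂ) ℂ a n]
  change ‖p n‖ ≤ _
  rw [hpq]
  refine (norm_cauchyPowerSeries_le f 0 r n).trans ?_
  rw [abs_of_nonneg r.coe_nonneg]
  gcongr
  have hint := intervalIntegral.norm_integral_le_of_norm_le_const (a := 0) (b := 2 * π)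
    (f := fun θ => ‖f (circleMap 0 r θ)‖) (C := M) (fun θ _ => by
      rw [norm_norm]
      exact hM _ (circleMap_mem_closedBall 0 r.coe_nonneg θ))
  rw [sub_zero, abs_of_pos Real.two_pi_pos] at hint
  rw [inv_mul_le_iff₀ Real.two_pi_pos, mul_comm _ M]
  exact (le_abs_self _).trans hint

/-- The coefficients of `(sin x / x) ^ lam` are summable, uniformly for `lam` in a disc. -/
theorem exists_summable_bound_coeff (c : ℕ → Polynomial ℂ)
    (hc : ∀ (lam : ℂ) (x : ℝ), x ∈ Set.Ioo (-π) π → x ≠ 0 →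
      HasSum (fun j : ℕ => (c j).eval lam * (x : ℂ) ^ (2 * j))
        (((Real.sin x / x : ℝ) : ℂ) ^ lam))
    (hsum : ∀ lam : ℂ, Summable fun j : ℕ => ‖(c j).eval lam‖) (R : ℝ) :
    ∃ u : ℕ → ℝ, Summable u ∧ ∀ j, ∀ lam : ℂ, ‖lam‖ ≤ R → ‖(c j).eval lam‖ ≤ u j := by
  let L : ℂ → ℂ := fun z => Complex.log (dslope Complex.sin 0 z)
  let r : NNReal := 6 / 5
  have hrc : (r : ℝ) = 6 / 5 := by simp [r]
  have hball : ∀ z ∈ Metric.closedBall (0 : ℂ) r, ‖z‖ < 5 / 4 := fun z hz => by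
    rw [mem_closedBall_zero_iff, hrc] at hz
    linarith
  have hS : DifferentiableOn ℂ (dslope Complex.sin 0) Set.univ :=
    (Complex.differentiableOn_dslope univ_mem).mpr Complex.differentiable_sin.differentiableOn
  have hL : DifferentiableOn ℂ L (Metric.closedBall 0 r) :=
    (hS.mono (Set.subset_univ _)).clog fun z hz => dslope_sin_mem_slitPlane (hball z hz)
  obtain ⟨B, hB⟩ := (isCompact_closedBall (0 : ℂ) r).exists_bound_of_continuousOn hL.continuousOn
  refine ⟨fun j => Real.exp (R * B) * ((r : ℝ)⁻¹ ^ 2) ^ j, ?_, fun j lam hlam => ?_⟩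
  · refine (summable_geometric_of_lt_one (by positivity) ?_).mul_left _
    rw [hrc]; norm_num
  · let a : ℕ → ℂ := fun n => if Even n then (c (n / 2)).eval lam else 0
    have hinj : Function.Injective fun j : ℕ => 2 * j := fun i j h => by simpa using h
    have hodd : ∀ n, n ∉ Set.range (fun j : ℕ => 2 * j) → a n = 0 := fun n hn =>
      if_neg fun he => hn (by obtain ⟨m, rfl⟩ := he; exact ⟨m, by simp; ring⟩)
    have haj : ∀ j, a (2 * j) = (c j).eval lam := fun j => by simp [a]
    dsimp only
    rw [← haj, ← pow_mul]
    refine norm_coeff_le_of_hasSum_real (f := fun z => Complex.exp (lam * L z)) (a := a) (r := r)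
      (by simp [r]) ((hL.const_mul lam).cexp) (fun z hz => ?_) ?_ (fun x hx0 hx1 => ?_) _
    · refine (Complex.norm_exp_le_exp_norm _).trans (Real.exp_le_exp.mpr ?_)
      rw [norm_mul]
      exact mul_le_mul hlam (hB z hz) (norm_nonneg _) ((norm_nonneg _).trans hlam)
    · refine (hinj.summable_iff fun n hn => by simp [hodd n hn]).mp ?_
      simpa [Function.comp_def, haj] using hsum lam
    · have hpi := Real.pi_gt_three
      have h := hc lam x ⟨by linarith, by linarith⟩ hx0.ne'
      have hsin := Real.sin_pos_of_pos_of_lt_pi hx0 (by linarith)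
      have hne : ((Real.sin x / x : ℝ) : ℂ) ≠ 0 :=
        Complex.ofReal_ne_zero.mpr (div_pos hsin hx0).ne'
      have hval : Complex.exp (lam * L x) = ((Real.sin x / x : ℝ) : ℂ) ^ lam := by
        rw [Complex.cpow_def_of_ne_zero hne, mul_comm]
        simp only [L]
        rw [dslope_of_ne _ (Complex.ofReal_ne_zero.mpr hx0.ne'), slope_def_field]
        simp
      rw [hval]
      refine (hinj.hasSum_iff fun n hn => by simp [hodd n hn]).mp ?_
      simpa only [Function.comp_def, haj] using h

section Series

variable {k : ℕ} {c : ℕ → Polynomial ℂ} {R : ℝ} {u : ℕ → ℝ} {N : ℕ}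

theorem norm_shifted_term_le (hu : ∀ j, ∀ lam : ℂ, ‖lam‖ ≤ R → ‖(c j).eval lam‖ ≤ u j)
    (hN : R ≤ N) (i : ℕ) {lam : ℂ} (hlam : ‖lam‖ ≤ R) :
    1 ≤ ‖lam + k + 2 * ((i + N : ℕ) : ℂ) + 1‖ ∧
      ‖(c (i + N)).eval lam / (lam + k + 2 * ((i + N : ℕ) : ℂ) + 1)‖ ≤ u (i + N) := by
  have h1 : 1 ≤ ‖lam + k + 2 * ((i + N : ℕ) : ℂ) + 1‖ := by
    refine le_trans ?_ ((le_abs_self _).trans (Complex.abs_re_le_norm _))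
    have hre := (abs_le.mp ((Complex.abs_re_le_norm lam).trans (hlam.trans hN))).1
    have hi : (0 : ℝ) ≤ i := i.cast_nonneg
    have hk : (0 : ℝ) ≤ k := k.cast_nonneg
    have hN0 : (0 : ℝ) ≤ N := N.cast_nonneg
    simp
    linarith
  refine ⟨h1, ?_⟩
  rw [norm_div]
  exact (div_le_self (norm_nonneg _) h1).trans (hu _ _ hlam)

theorem summable_coeff_div (hsu : Summable u)
    (hu : ∀ j, ∀ lam : ℂ, ‖lam‖ ≤ R → ‖(c j).eval lam‖ ≤ u j) {lam : ℂ} (hlam : ‖lam‖ ≤ R) :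
    Summable fun j : ℕ => (c j).eval lam / (lam + k + 2 * j + 1) := by
  obtain ⟨N, hN⟩ := exists_nat_ge R
  rw [← summable_nat_add_iff N]
  exact Summable.of_norm_bounded ((summable_nat_add_iff N).mpr hsu)
    fun i => (norm_shifted_term_le hu hN i hlam).2

theorem differentiableOn_tail (hsu : Summable u)
    (hu : ∀ j, ∀ lam : ℂ, ‖lam‖ ≤ R → ‖(c j).eval lam‖ ≤ u j) (hN : R ≤ N) :
    DifferentiableOn ℂ
      (fun lam : ℂ => ∑' i : ℕ, (c (i + N)).eval lam / (lam + k + 2 * ((i + N : ℕ) : ℂ) + 1))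
      (Metric.ball 0 R) := by
  have hle : ∀ w ∈ Metric.ball (0 : ℂ) R, ‖w‖ ≤ R := fun w hw => (mem_ball_zero_iff.mp hw).le
  refine Complex.differentiableOn_tsum_of_summable_norm ((summable_nat_add_iff N).mpr hsu)
    (fun i => ?_) Metric.isOpen_ball (fun i w hw => (norm_shifted_term_le hu hN i (hle w hw)).2)
  refine (c (i + N)).differentiable.differentiableOn.fun_div (by fun_prop) fun w hw => ?_
  have h := (norm_shifted_term_le (k := k) hu hN i (hle w hw)).1
  exact norm_pos_iff.mp (by linarith)

end Series

theorem hasSum_integral_sin_cpow (k : ℕ) (c : ℕ → Polynomial ℂ)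
    (hc : ∀ (lam : ℂ) (x : ℝ), x ∈ Set.Ioo (-π) π → x ≠ 0 →
      HasSum (fun j : ℕ => (c j).eval lam * (x : ℂ) ^ (2 * j))
        (((Real.sin x / x : ℝ) : ℂ) ^ lam))
    (hsum : ∀ lam : ℂ, Summable fun j : ℕ => ‖(c j).eval lam‖)
    {lam : ℂ} (hlam : -(k + 1 : ℝ) < lam.re) :
    HasSum (fun j : ℕ => (c j).eval lam / (lam + k + 2 * j + 1))
      (∫ x in Set.Ioc (0 : ℝ) 1, (x : ℂ) ^ (k : ℕ) * ((|Real.sin x| : ℝ) : ℂ) ^ lam) := by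
  have hj0 (j : ℕ) : (0 : ℝ) ≤ j := j.cast_nonneg
  have hre (j : ℕ) : -1 < (lam + k + 2 * j).re := by
    have := hj0 j
    simp
    linarith
  let f : ℕ → ℝ → ℂ := fun j x => (c j).eval lam * (x : ℂ) ^ (lam + k + 2 * j)
  have hint (j : ℕ) : Integrable (f j) (volume.restrict (Set.Ioc 0 1)) :=
    ((intervalIntegrable_iff_integrableOn_Ioc_of_le zero_le_one).mp
      (intervalIntegral.intervalIntegrable_cpow' (hre j))).const_mul _
  have hval (j : ℕ) : ∫ x in Set.Ioc (0 : ℝ) 1, f j x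
      = (c j).eval lam / (lam + k + 2 * j + 1) := by
    have hne : lam + k + 2 * j + 1 ≠ 0 := fun h => by
      have h' := congrArg Complex.re h
      have := hre j
      rw [Complex.add_re, Complex.one_re, Complex.zero_re] at h'
      linarith
    rw [integral_const_mul, ← intervalIntegral.integral_of_le zero_le_one,
      integral_cpow (Or.inl (hre j))]
    simp [Complex.zero_cpow hne, div_eq_mul_inv]
  have hnorm (j : ℕ) : ∫ x in Set.Ioc (0 : ℝ) 1, ‖f j x‖
      ≤ ‖(c j).eval lam‖ * (lam.re + k + 1)⁻¹ := by
    have : ∫ x in Set.Ioc (0 : ℝ) 1, ‖f j x‖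
        = ∫ x in Set.Ioc (0 : ℝ) 1, ‖(c j).eval lam‖ * x ^ (lam + k + 2 * j).re :=
      setIntegral_congr_fun measurableSet_Ioc fun x hx => by
        simp only [f, norm_mul, Complex.norm_cpow_eq_rpow_re_of_pos hx.1]
    rw [this, integral_const_mul, ← intervalIntegral.integral_of_le zero_le_one,
      integral_rpow (Or.inl (hre j)), Real.one_rpow,
      Real.zero_rpow (by have := hre j; linarith), sub_zero, one_div]
    gcongr
    · linarith
    · have := hj0 j
      simp
  have hS := hasSum_integral_of_summable_integral_norm hint
    (Summable.of_nonneg_of_le (fun j => integral_nonneg fun x => norm_nonneg (f j x)) hnorm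
      ((hsum lam).mul_right _))
  simp only [hval] at hS
  suffices ∫ x in Set.Ioc (0 : ℝ) 1, (x : ℂ) ^ (k : ℕ) * ((|Real.sin x| : ℝ) : ℂ) ^ lam
      = ∫ x in Set.Ioc (0 : ℝ) 1, ∑' j, f j x by rwa [this]
  refine setIntegral_congr_fun measurableSet_Ioc fun x hx => ?_
  have hpi := Real.pi_gt_three
  have hxpi : x < π := by linarith [hx.2]
  have hx0 : (x : ℂ) ≠ 0 := Complex.ofReal_ne_zero.mpr hx.1.ne'
  have hsin := Real.sin_pos_of_pos_of_lt_pi hx.1 hxpi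
  have h := ((hc lam x ⟨by linarith [hx.1], hxpi⟩ hx.1.ne').mul_left
    ((x : ℂ) ^ k * (x : ℂ) ^ lam)).tsum_eq
  have hsplit : ((|Real.sin x| : ℝ) : ℂ) ^ lam
      = (x : ℂ) ^ lam * ((Real.sin x / x : ℝ) : ℂ) ^ lam := by
    rw [← Complex.mul_cpow_ofReal_nonneg hx.1.le (div_pos hsin hx.1).le, ← Complex.ofReal_mul,
      mul_div_cancel₀ _ hx.1.ne', abs_of_pos hsin]
  rw [hsplit, ← mul_assoc, ← h]
  refine tsum_congr fun j => ?_
  simp only [f]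
  rw [Complex.cpow_add _ _ hx0, Complex.cpow_add _ _ hx0, Complex.cpow_natCast,
    show (2 * (j : ℂ)) = ((2 * j : ℕ) : ℂ) by push_cast; rfl, Complex.cpow_natCast]
  ring

/-- Meromorphic extension of `I_k(λ) = ∫₀¹ x^k |sin x|^λ dx`.

Here `c j` are the polynomial coefficients of the expansion
`(sin x / x)^λ = ∑_j c_j(λ) x^{2j}` on `(-π, π)` (hypotheses `hc`, `hsum`).
There exists `F : ℂ → ℂ` which agrees with the integral for `Re λ > -(k+1)`,
is given by the series `∑_j c_j(λ)/(λ + k + 2j + 1)` away from the points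
`λ = -(k+2j+1)`, is holomorphic there, and has `lim (λ + (k+2j+1)) F(λ) = c_j(-(k+2j+1))`,
so each `λ = -(k+2j+1)` is (at most) a simple pole with residue `c_j(-(k+2j+1))`. -/
theorem stmt8 (k : ℕ) (c : ℕ → Polynomial ℂ)
    (hc : ∀ (lam : ℂ) (x : ℝ), x ∈ Set.Ioo (-π) π → x ≠ 0 →
      HasSum (fun j : ℕ => (c j).eval lam * (x : ℂ) ^ (2 * j))
        (((Real.sin x / x : ℝ) : ℂ) ^ lam))
    (hsum : ∀ lam : ℂ, Summable fun j : ℕ => ‖(c j).eval lam‖) :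
    ∃ F : ℂ → ℂ,
      (∀ lam : ℂ, -(k + 1 : ℝ) < lam.re →
        F lam = ∫ x in Set.Ioc (0 : ℝ) 1, (x : ℂ) ^ (k : ℕ) * ((|Real.sin x| : ℝ) : ℂ) ^ lam) ∧
      (∀ lam : ℂ, (∀ j : ℕ, lam ≠ -((k : ℂ) + 2 * j + 1)) →
        HasSum (fun j : ℕ => (c j).eval lam / (lam + k + 2 * j + 1)) (F lam)) ∧
      DifferentiableOn ℂ F {lam : ℂ | ∀ j : ℕ, lam ≠ -((k : ℂ) + 2 * j + 1)} ∧
      (∀ j : ℕ,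
        Tendsto (fun lam : ℂ => (lam + ((k : ℂ) + 2 * j + 1)) * F lam)
          (𝓝[{lam : ℂ | ∀ j' : ℕ, lam ≠ -((k : ℂ) + 2 * j' + 1)}] (-((k : ℂ) + 2 * j + 1)))
          (𝓝 ((c j).eval (-((k : ℂ) + 2 * j + 1))))) := by
  let F : ℂ → ℂ := fun lam => ∑' j : ℕ, (c j).eval lam / (lam + k + 2 * j + 1)
  have hS (lam : ℂ) : Summable fun j : ℕ => (c j).eval lam / (lam + k + 2 * j + 1) := by
    obtain ⟨u, hsu, hu⟩ := exists_summable_bound_coeff c hc hsum ‖lam‖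
    exact summable_coeff_div hsu hu le_rfl
  have hsplit (R : ℝ) : ∃ (N : ℕ) (T : ℂ → ℂ), DifferentiableOn ℂ T (Metric.ball 0 R) ∧ R ≤ N ∧
      F = fun lam => ∑ j ∈ Finset.range N, (c j).eval lam / (lam + k + 2 * j + 1) + T lam := by
    obtain ⟨u, hsu, hu⟩ := exists_summable_bound_coeff c hc hsum R
    obtain ⟨N, hN⟩ := exists_nat_ge R
    exact ⟨N, _, differentiableOn_tail (k := k) hsu hu hN, hN,
      funext fun lam => ((hS lam).sum_add_tsum_nat_add N).symm⟩
  refine ⟨F, fun lam hlam => (hasSum_integral_sin_cpow k c hc hsum hlam).tsum_eq,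
    fun lam _ => (hS lam).hasSum, fun lam hlam => ?_, fun j => ?_⟩
  · obtain ⟨N, T, hT, -, hF⟩ := hsplit (‖lam‖ + 1)
    have hTd : DifferentiableAt ℂ T lam :=
      hT.differentiableAt (Metric.isOpen_ball.mem_nhds (by simp))
    rw [hF]
    refine (DifferentiableAt.fun_add (DifferentiableAt.fun_sum fun i _ => ?_)
      hTd).differentiableWithinAt
    refine (c i).differentiableAt.fun_div (by fun_prop) fun h => hlam i ?_
    linear_combination h
  · set p : ℂ := -((k : ℂ) + 2 * j + 1) with hp
    obtain ⟨N, T, hT, hN, hF⟩ := hsplit (‖p‖ + 1)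
    have hTc : ContinuousAt T p :=
      (hT.differentiableAt (Metric.isOpen_ball.mem_nhds (by simp))).continuousAt
    have hjN : j < N := by
      have h1 := (Complex.abs_re_le_norm p)
      have h2 : p.re = -((k : ℝ) + 2 * j + 1) := by simp [hp]
      rw [h2, abs_neg] at h1
      have h3 := (le_abs_self _).trans h1
      have hk : (0 : ℝ) ≤ k := k.cast_nonneg
      have hj : (0 : ℝ) ≤ j := j.cast_nonneg
      exact_mod_cast (show (j : ℝ) < N by linarith)
    have hlin : Tendsto (fun lam : ℂ => lam + ((k : ℂ) + 2 * j + 1)) (𝓝 p) (𝓝 0) :=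
      Continuous.tendsto' (by fun_prop) _ _ (by rw [hp]; ring)
    have hterm (i : ℕ) : Tendsto
        (fun lam : ℂ => (lam + ((k : ℂ) + 2 * j + 1)) *
          ((c i).eval lam / (lam + k + 2 * i + 1)))
        (𝓝[{lam : ℂ | ∀ j' : ℕ, lam ≠ -((k : ℂ) + 2 * j' + 1)}] p)
        (𝓝 (if i = j then (c j).eval p else 0)) := by
      split_ifs with hij
      · subst hij
        refine Tendsto.congr' ?_
          (((c i).continuous.tendsto p).mono_left nhdsWithin_le_nhds)
        filter_upwards [self_mem_nhdsWithin] with lam hlam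
        have hne : lam + k + 2 * i + 1 ≠ 0 := fun h => hlam i (by linear_combination h)
        rw [show lam + ((k : ℂ) + 2 * i + 1) = lam + k + 2 * i + 1 by ring,
          mul_div_cancel₀ _ hne]
      · have hne : p + k + 2 * i + 1 ≠ 0 := fun h => hij (by
          have h' : (i : ℂ) = j := by rw [hp] at h; linear_combination h / 2
          exact_mod_cast h')
        have hcont : ContinuousAt
            (fun lam : ℂ => (c i).eval lam / (lam + k + 2 * i + 1)) p :=
          (c i).continuous.continuousAt.div (by fun_prop) hne
        simpa using (hlin.mul hcont.tendsto).mono_left nhdsWithin_le_nhds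
    have hlim := (tendsto_finsetSum (Finset.range N) fun i _ => hterm i).add
      ((hlin.mul hTc.tendsto).mono_left nhdsWithin_le_nhds)
    simpa [hF, mul_add, Finset.mul_sum, hjN] using hlim
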